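/- With the L[y]-module structure on L{τ}τ defined by (c y^i) * η = c η φ_x^i for a Drinfeld module φ of rank r, the set {τ, τ^2, ..., τ^r} is a basis of L{τ}τ as a free L[y]-module of rank r. -/

import Mathlib

open Polynomial

/-- Twisted ("skew") multiplication on polynomials in `τ` (represented by `Polynomial.X`):
multiplication is induced by the commutation rule `τ * u = u ^ q * τ` for `u : L`,
so `(a τ^i) * (b τ^j) = a * b^(q^i) * τ^(i+j)`. -/
noncomputable def tmul (q : ℕ) {L : Type*} [CommRing L] (f g : Polynomial L) : Polynomial L :=
  f.sum fun i a => g.sum fun j b => Polynomial.C (a * b ^ q ^ i) * Polynomial.X ^ (i + j)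

/-- Powers with respect to the twisted multiplication `tmul`. -/
noncomputable def tpow (q : ℕ) {L : Type*} [CommRing L] (f : Polynomial L) : ℕ → Polynomial L
  | 0 => 1
  | n + 1 => tmul q f (tpow q f n)

/-- The action of `g ∈ L[y]` on a twisted polynomial `η`, where `y` acts as right
(twisted) multiplication by `φx`: `(c yʲ) * η = c • (η ⬝ φxʲ)`. -/
noncomputable def pact (q : ℕ) {L : Type*} [CommRing L] (g φx η : Polynomial L) : Polynomial L :=
  g.sum fun j c => Polynomial.C c * tmul q η (tpow q φx j)

section TwistedPolynomial

variable {L : Type*} [Field L]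

theorem coeff_tmul (q : ℕ) (f g : L[X]) (N : ℕ) :
    (tmul q f g).coeff N =
      ∑ i ∈ f.support, ∑ j ∈ g.support,
        if N = i + j then f.coeff i * g.coeff j ^ q ^ i else 0 := by
  simp only [tmul, Polynomial.sum_def, finsetSum_coeff, coeff_C_mul, coeff_X_pow, mul_ite,
    mul_one, mul_zero]

theorem natDegree_tmul_le {q m n : ℕ} {f g : L[X]} (hf : f.natDegree ≤ m)
    (hg : g.natDegree ≤ n) : (tmul q f g).natDegree ≤ m + n := by
  rw [natDegree_le_iff_coeff_eq_zero]
  intro N hN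
  rw [coeff_tmul]
  refine Finset.sum_eq_zero fun i hi => Finset.sum_eq_zero fun j hj => if_neg ?_
  have := le_natDegree_of_mem_supp i hi
  have := le_natDegree_of_mem_supp j hj
  omega

theorem coeff_tmul_add {q m n : ℕ} (hq : q ≠ 0) {f g : L[X]} (hf : f.natDegree ≤ m)
    (hg : g.natDegree ≤ n) :
    (tmul q f g).coeff (m + n) = f.coeff m * g.coeff n ^ q ^ m := by
  rw [coeff_tmul, Finset.sum_eq_single m, Finset.sum_eq_single n, if_pos rfl]
  · intro j _ hj
    exact if_neg (by omega)
  · intro hn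
    simp [notMem_support_iff.mp hn, hq]
  · intro i hi him
    refine Finset.sum_eq_zero fun j hj => if_neg ?_
    have := le_natDegree_of_mem_supp i hi
    have := le_natDegree_of_mem_supp j hj
    omega
  · intro hm
    simp [notMem_support_iff.mp hm]

theorem coeff_zero_tmul {q : ℕ} {f g : L[X]} (hf : f.coeff 0 = 0) :
    (tmul q f g).coeff 0 = 0 := by
  rw [coeff_tmul]
  refine Finset.sum_eq_zero fun i hi => Finset.sum_eq_zero fun j _ => if_neg ?_
  intro h
  obtain rfl : i = 0 := by omega
  exact mem_support_iff.mp hi hf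

theorem natDegree_tpow_le {q r : ℕ} {f : L[X]} (hf : f.natDegree ≤ r) (j : ℕ) :
    (tpow q f j).natDegree ≤ r * j := by
  induction j with
  | zero => simp [tpow]
  | succ j ih =>
    rw [tpow, Nat.mul_succ, add_comm]
    exact natDegree_tmul_le hf ih

theorem coeff_tpow_ne_zero {q r : ℕ} (hq : q ≠ 0) {f : L[X]} (hf : f.natDegree ≤ r)
    (hfr : f.coeff r ≠ 0) (j : ℕ) : (tpow q f j).coeff (r * j) ≠ 0 := by
  induction j with
  | zero => simp [tpow]
  | succ j ih =>
    rw [tpow, Nat.mul_succ, add_comm, coeff_tmul_add hq hf (natDegree_tpow_le hf j)]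
    exact mul_ne_zero hfr (pow_ne_zero _ ih)

theorem degree_divX_tmul_X_pow {q r : ℕ} (hq : q ≠ 0) {f : L[X]} (hf : f.natDegree ≤ r)
    (hfr : f.coeff r ≠ 0) (i j : ℕ) :
    (tmul q (X ^ (i + 1)) (tpow q f j)).divX.degree = ((i + r * j : ℕ) : WithBot ℕ) := by
  have hX : (X ^ (i + 1) : L[X]).natDegree ≤ i + 1 := natDegree_X_pow_le _
  refine degree_eq_of_le_of_coeff_ne_zero ?_ ?_
  · refine natDegree_le_iff_degree_le.mp ?_
    have := natDegree_tmul_le (q := q) hX (natDegree_tpow_le (q := q) hf j)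
    rw [natDegree_divX_eq_natDegree_tsub_one]
    omega
  · rw [coeff_divX, add_right_comm, coeff_tmul_add hq hX (natDegree_tpow_le hf j)]
    simpa using pow_ne_zero _ (coeff_tpow_ne_zero hq hf hfr j)

/-- The polynomials `τ ^ (i + 1) * φ ^ j` with `i < r`, divided by `τ` and ordered by degree. -/
noncomputable def twistedSequence {q r : ℕ} (hq : q ≠ 0) {f : L[X]} (hf : f.natDegree ≤ r)
    (hfr : f.coeff r ≠ 0) : Polynomial.Sequence L where
  elems' n := (tmul q (X ^ (n % r + 1)) (tpow q f (n / r))).divX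
  degree_eq' n := by rw [degree_divX_tmul_X_pow hq hf hfr, Nat.mod_add_div]

theorem exists_basis_divX_tmul {q r : ℕ} [NeZero r] (hq : q ≠ 0) {f : L[X]}
    (hf : f.natDegree ≤ r) (hfr : f.coeff r ≠ 0) :
    ∃ B : Module.Basis (Σ _ : Fin r, ℕ) L L[X],
      ∀ i j, B ⟨i, j⟩ = (tmul q (X ^ ((i : ℕ) + 1)) (tpow q f j)).divX := by
  let S := twistedSequence hq hf hfr
  have hS : ∀ n, IsUnit (S n).leadingCoeff := fun n =>
    (leadingCoeff_ne_zero.mpr (S.ne_zero n)).isUnit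
  refine ⟨(S.basis hS).reindex (((Nat.divModEquiv r).trans (Equiv.prodComm _ _)).trans
    (Equiv.sigmaEquivProd _ _).symm), fun i j => ?_⟩
  rw [Module.Basis.reindex_apply, Polynomial.Sequence.basis_eq_self]
  have hr : 0 < r := Nat.pos_of_ne_zero (NeZero.ne r)
  have hmod : (j * r + (i : ℕ)) % r = i := Nat.mul_add_mod_of_lt i.2
  have hdiv : (j * r + (i : ℕ)) / r = j := by
    rw [mul_comm, Nat.mul_add_div hr, Nat.div_eq_of_lt i.2, add_zero]
  change (tmul q (X ^ ((j * r + (i : ℕ)) % r + 1)) (tpow q f ((j * r + (i : ℕ)) / r))).divX = _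
  rw [hmod, hdiv]

theorem existsUnique_sum_pact {q r : ℕ} [NeZero r] (hq : q ≠ 0) {φ : L[X]}
    (hφ : φ.natDegree ≤ r) (hφr : φ.coeff r ≠ 0) {f : L[X]} (hf : f.coeff 0 = 0) :
    ∃! g : Fin r → L[X], f = ∑ i : Fin r, pact q (g i) φ (X ^ ((i : ℕ) + 1)) := by
  obtain ⟨B, hB⟩ := exists_basis_divX_tmul hq hφ hφr
  have hX : ∀ {u : L[X]}, u.coeff 0 = 0 → u.divX * X = u := fun {u} hu => by
    simpa [hu] using divX_mul_X_add u
  let E : (Fin r → L[X]) ≃ ((Σ _ : Fin r, ℕ) →₀ L) :=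
    (Equiv.piCongrRight fun _ => (toFinsuppIso L).toEquiv.trans
      AddMonoidAlgebra.coeffEquiv).trans Finsupp.sigmaFinsuppEquivPiFinsupp.symm
  have hE : ∀ g i j, E g ⟨i, j⟩ = (g i).coeff j := fun g i j => rfl
  have key : ∀ g : Fin r → L[X],
      ∑ i : Fin r, pact q (g i) φ (X ^ ((i : ℕ) + 1)) = B.repr.symm (E g) * X := by
    intro g
    have hsupp : (E g).support ⊆ Finset.univ.sigma fun i => (g i).support := by
      rintro ⟨i, j⟩ h
      simpa [hE] using h
    rw [Module.Basis.repr_symm_apply, Finsupp.linearCombination_apply,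
      Finsupp.sum_of_support_subset _ hsupp _ (by simp), Finset.sum_sigma, Finset.sum_mul]
    refine Finset.sum_congr rfl fun i _ => ?_
    rw [pact, Polynomial.sum_def, Finset.sum_mul]
    refine Finset.sum_congr rfl fun j _ => ?_
    rw [hE, hB, smul_mul_assoc, hX (coeff_zero_tmul (by simp)), smul_eq_C_mul]
  refine ⟨E.symm (B.repr f.divX), ?_, fun g hg => ?_⟩
  · simp [key, hX hf]
  · rw [Equiv.eq_symm_apply, ← LinearEquiv.symm_apply_eq]
    refine mul_right_cancel₀ (X_ne_zero (R := L)) ?_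
    rw [hX hf, ← key]
    exact hg.symm

end TwistedPolynomial

/-- With the `L[y]`-module structure on `L{τ}τ` given by
`(c yⁱ) * η = c η φ_xⁱ` for a rank `r` Drinfeld module `φ`, the family `(τ, τ², …, τʳ)`
is a basis of `L{τ}τ` as a free `L[y]`-module of rank `r`: every `f ∈ L{τ}τ`
(i.e. with zero constant term) has a unique coordinate vector `g : Fin r → L[y]`. -/
theorem stmt5 (q p e r : ℕ) (L : Type*) [Field L] [Fintype L] [Fact p.Prime] [CharP L p]
    (he : 0 < e) (hq : q = p ^ e)
    (γx : L) (Δ : ℕ → L) (hΔ0 : Δ 0 = γx) (hΔr : Δ r ≠ 0) (hr : 1 ≤ r)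
    (φx : Polynomial L)
    (hφx : φx = ∑ i ∈ Finset.range (r + 1), Polynomial.C (Δ i) * Polynomial.X ^ i)
    (f : Polynomial L) (hf : f.coeff 0 = 0) :
    ∃! g : Fin r → Polynomial L,
      f = ∑ i : Fin r, pact q (g i) φx (Polynomial.X ^ ((i : ℕ) + 1)) := by
  have : NeZero r := ⟨by omega⟩
  have hcoeff : ∀ n, φx.coeff n = if n < r + 1 then Δ n else 0 := fun n => by
    simp [hφx, finsetSum_coeff, coeff_X_pow]
  refine existsUnique_sum_pact ?_ ?_ ?_ hf
  · exact hq ▸ pow_ne_zero e (Fact.out : p.Prime).ne_zero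
  · rw [natDegree_le_iff_coeff_eq_zero]
    intro n hn
    rw [hcoeff, if_neg (by omega)]
  · rwa [hcoeff, if_pos (Nat.lt_succ_self r)]
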